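/- Let d ≥ 1, δ > 0, and let N, m be positive integers. Suppose H_1,…,H_{d+1} ∈ M_{2N}(ℂ) satisfy H_r† = H_r♯ = H_r for all r, ‖Σ_{r=1}^{d+1} H_r² − I‖ ≤ δ, and ‖[H_r,H_s]‖ ≤ δ for all r ≠ s. Suppose ν_1,…,ν_{d+1} ∈ M_{2m}(ℂ) are unitary matrices with ν_r† ν_s = −ν_s† ν_r for r ≠ s. Let Z_N ∈ M_{2N}(ℂ) and Z_m ∈ M_{2m}(ℂ) be the matrices defining the respective dual operations, let U := (1/√2)(I − i Z_N ⊗ Z_m), and set B := U† (Σ_{r=1}^{d+1} H_r ⊗ ν_r) U. Then: (1) U is unitary and ‖B†B − I‖ ≤ (1 + d(d+1)/2)·δ; (2) if ν_r† = ν_r for all r, then B† = B; (3) if ν_r♯ = ν_r for all r, then Bᵀ = B; (4) if ν_r♯ = −ν_r for all r, then Bᵀ = −B. -/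

import Mathlib

open Matrix
open scoped Kronecker ComplexOrder

/-- The ℓ²→ℓ² operator norm of a complex matrix. -/
noncomputable def opNorm {n : Type*} [Fintype n] [DecidableEq n] (A : Matrix n n ℂ) : ℝ :=
  ‖Matrix.toEuclideanCLM (𝕜 := ℂ) (n := n) A‖

/-- The 2N×2N matrix `Z = [[0, -I],[I, 0]]`. -/
noncomputable def Zmat (N : ℕ) : Matrix (Fin N ⊕ Fin N) (Fin N ⊕ Fin N) ℂ :=
  Matrix.fromBlocks 0 (-1) 1 0

/-- The dual `X♯ = -Z Xᵀ Z` of a 2N×2N complex matrix. -/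
noncomputable def dual {N : ℕ} (X : Matrix (Fin N ⊕ Fin N) (Fin N ⊕ Fin N) ℂ) :
    Matrix (Fin N ⊕ Fin N) (Fin N ⊕ Fin N) ℂ :=
  -(Zmat N) * Xᵀ * (Zmat N)

open scoped Matrix.Norms.L2Operator in
theorem opNorm_eq_l2 {n : Type*} [Fintype n] [DecidableEq n] (A : Matrix n n ℂ) :
    opNorm A = ‖A‖ := rfl

/-- `A ↦ A ⊗ 1` as a star algebra homomorphism. -/
noncomputable def kronOneHom (n k : Type*) [Fintype n] [DecidableEq n] [Fintype k] [DecidableEq k] :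
    Matrix n n ℂ →⋆ₙₐ[ℂ] Matrix (n × k) (n × k) ℂ where
  toFun A := A ⊗ₖ (1 : Matrix k k ℂ)
  map_smul' c A := by simp [smul_kronecker]
  map_zero' := by simp
  map_add' A B := by simp [add_kronecker]
  map_mul' A B := by simp [← mul_kronecker_mul]
  map_star' A := by simp [star_eq_conjTranspose, conjTranspose_kronecker]

open scoped Matrix.Norms.L2Operator in
theorem norm_kron_one_le {n k : Type*} [Fintype n] [DecidableEq n] [Fintype k] [DecidableEq k]
    (A : Matrix n n ℂ) : ‖A ⊗ₖ (1 : Matrix k k ℂ)‖ ≤ ‖A‖ :=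
  NonUnitalStarAlgHom.norm_apply_le (kronOneHom n k) A

theorem mem_unitary_of_left {n : Type*} [Fintype n] [DecidableEq n] {V : Matrix n n ℂ}
    (h : Vᴴ * V = 1) : V ∈ unitary (Matrix n n ℂ) :=
  ⟨h, mul_eq_one_comm.mp h⟩

open scoped Matrix.Norms.L2Operator in
theorem norm_kron_unitary_le {n k : Type*} [Fintype n] [DecidableEq n] [Fintype k] [DecidableEq k]
    (A : Matrix n n ℂ) (V : Matrix k k ℂ) (hV : Vᴴ * V = 1) : ‖A ⊗ₖ V‖ ≤ ‖A‖ := by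
  have h1 : A ⊗ₖ V = (A ⊗ₖ (1 : Matrix k k ℂ)) * ((1 : Matrix n n ℂ) ⊗ₖ V) := by
    rw [← mul_kronecker_mul]; simp
  have h2 : ((1 : Matrix n n ℂ) ⊗ₖ V) ∈ unitary (Matrix (n × k) (n × k) ℂ) := by
    apply mem_unitary_of_left
    rw [conjTranspose_kronecker, ← mul_kronecker_mul, hV]; simp
  rw [h1, CStarRing.norm_mul_mem_unitary _ h2]
  exact norm_kron_one_le A

theorem Zmat_sq (N : ℕ) : Zmat N * Zmat N = -1 := by
  rw [Zmat, fromBlocks_multiply, ← fromBlocks_one, fromBlocks_neg]; simp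

theorem Zmat_transpose (N : ℕ) : (Zmat N)ᵀ = -Zmat N := by
  rw [Zmat, fromBlocks_transpose, fromBlocks_neg]; simp

theorem Zmat_conjTranspose (N : ℕ) : (Zmat N)ᴴ = -Zmat N := by
  rw [Zmat, fromBlocks_conjTranspose, fromBlocks_neg]; simp

theorem transpose_eq_dual {N : ℕ} (X : Matrix (Fin N ⊕ Fin N) (Fin N ⊕ Fin N) ℂ) :
    Xᵀ = -(Zmat N * dual X * Zmat N) := by
  have : Zmat N * dual X * Zmat N = -((Zmat N * Zmat N) * Xᵀ * (Zmat N * Zmat N)) := by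
    simp [dual, mul_assoc]
  rw [this, Zmat_sq]; simp

theorem neg_kron_neg {n k : Type*} (A : Matrix n n ℂ) (B : Matrix k k ℂ) :
    (-A) ⊗ₖ (-B) = A ⊗ₖ B := by
  ext i j; simp [kroneckerMap_apply]

theorem kron_neg {n k : Type*} (A : Matrix n n ℂ) (B : Matrix k k ℂ) :
    A ⊗ₖ (-B) = -(A ⊗ₖ B) := by
  ext i j; simp [kroneckerMap_apply]

theorem sub_kron {n k : Type*} (A A' : Matrix n n ℂ) (B : Matrix k k ℂ) :
    (A - A') ⊗ₖ B = A ⊗ₖ B - A' ⊗ₖ B := by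
  ext i j; simp [kroneckerMap_apply, sub_mul]

theorem sum_kron {ι n k : Type*} [Fintype ι] (A : ι → Matrix n n ℂ) (B : Matrix k k ℂ) :
    (∑ r, A r) ⊗ₖ B = ∑ r, A r ⊗ₖ B := by
  ext i j; simp [kroneckerMap_apply, Matrix.sum_apply, Finset.sum_mul]

theorem kron_transpose {n k : Type*} (A : Matrix n n ℂ) (B : Matrix k k ℂ) :
    (A ⊗ₖ B)ᵀ = Aᵀ ⊗ₖ Bᵀ := by
  ext i j; simp [kroneckerMap_apply]

section Main
open scoped Matrix.Norms.L2Operator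

theorem gram_bound {n k : Type*} [Fintype n] [DecidableEq n] [Fintype k] [DecidableEq k]
    (d : ℕ) (δ : ℝ) (H : Fin (d + 1) → Matrix n n ℂ) (hH : ∀ r, (H r)ᴴ = H r)
    (hsq : ‖∑ r, H r * H r - 1‖ ≤ δ)
    (hcomm : ∀ r s, r ≠ s → ‖H r * H s - H s * H r‖ ≤ δ)
    (ν : Fin (d + 1) → Matrix k k ℂ)
    (hu : ∀ r, (ν r)ᴴ * ν r = 1)
    (ha : ∀ r s, r ≠ s → (ν r)ᴴ * ν s = -((ν s)ᴴ * ν r)) :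
    ‖(∑ r, H r ⊗ₖ ν r)ᴴ * (∑ r, H r ⊗ₖ ν r) - 1‖ ≤ (1 + (d * (d + 1) : ℝ) / 2) * δ := by
  set S := ∑ r, H r ⊗ₖ ν r with hS
  have e1 : Sᴴ * S = ∑ r, ∑ s, (H r * H s) ⊗ₖ ((ν r)ᴴ * ν s) := by
    rw [hS, conjTranspose_sum, Finset.sum_mul]
    refine Finset.sum_congr rfl fun r _ => ?_
    rw [Finset.mul_sum]
    refine Finset.sum_congr rfl fun s _ => ?_
    rw [conjTranspose_kronecker, hH, ← mul_kronecker_mul]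
  have e2 : Sᴴ * S = ∑ r, ∑ s, (H s * H r) ⊗ₖ ((ν s)ᴴ * ν r) := by
    rw [e1, Finset.sum_comm]
  have e3 : Sᴴ * S + Sᴴ * S = ∑ r, ∑ s, ((H r * H s - H s * H r) ⊗ₖ ((ν r)ᴴ * ν s) +
      if r = s then (2 : ℂ) • ((H r * H r) ⊗ₖ (1 : Matrix k k ℂ)) else 0) := by
    nth_rw 1 [e1]
    rw [e2, ← Finset.sum_add_distrib]
    refine Finset.sum_congr rfl fun r _ => ?_
    rw [← Finset.sum_add_distrib]
    refine Finset.sum_congr rfl fun s _ => ?_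
    by_cases h : r = s
    · subst h
      simp [hu, two_smul]
    · rw [if_neg h, ha s r (Ne.symm h), kron_neg, sub_kron]
      abel
  have e4 : (2 : ℂ) • (Sᴴ * S - 1) = (2 : ℂ) • ((∑ r, H r * H r - 1) ⊗ₖ (1 : Matrix k k ℂ)) +
      ∑ r, ∑ s, (H r * H s - H s * H r) ⊗ₖ ((ν r)ᴴ * ν s) := by
    rw [smul_sub, two_smul ℂ (Sᴴ * S), e3, sub_kron, sum_kron, one_kronecker_one, smul_sub,
      Finset.smul_sum]
    simp only [Finset.sum_add_distrib, Finset.sum_ite_eq, Finset.mem_univ, if_true]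
    abel
  have n1 : ‖(∑ r, ∑ s, (H r * H s - H s * H r) ⊗ₖ ((ν r)ᴴ * ν s) :
      Matrix (n × k) (n × k) ℂ)‖ ≤ (d * (d + 1)) * δ := by
    have hb : ∀ r s, ‖(H r * H s - H s * H r) ⊗ₖ ((ν r)ᴴ * ν s)‖ ≤
        (δ - if r = s then δ else 0) := by
      intro r s
      by_cases h : r = s
      · subst h; simp
      · rw [if_neg h, sub_zero]
        refine (norm_kron_unitary_le _ _ ?_).trans (hcomm r s h)
        have : ν r * (ν r)ᴴ = 1 := mul_eq_one_comm.mp (hu r)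
        rw [conjTranspose_mul, conjTranspose_conjTranspose, mul_assoc, ← mul_assoc (ν r), this,
          one_mul, hu]
    calc _ ≤ ∑ r, ∑ s, ‖(H r * H s - H s * H r) ⊗ₖ ((ν r)ᴴ * ν s)‖ :=
          (norm_sum_le _ _).trans (Finset.sum_le_sum fun r _ => norm_sum_le _ _)
      _ ≤ ∑ r : Fin (d+1), ∑ s : Fin (d+1), (δ - if r = s then δ else 0) :=
          Finset.sum_le_sum fun r _ => Finset.sum_le_sum fun s _ => hb r s
      _ = _ := by
          simp [Finset.sum_sub_distrib]
          ring
  have n2 : ‖(2 : ℂ) • (Sᴴ * S - 1)‖ ≤ 2 * δ + (d * (d + 1)) * δ := by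
    rw [e4]
    refine (norm_add_le _ _).trans (add_le_add ?_ n1)
    rw [norm_smul]
    simpa using (norm_kron_one_le (k := k) _).trans hsq
  rw [norm_smul] at n2
  simp only [Complex.norm_ofNat] at n2
  linarith

end Main

theorem U_facts {n : Type*} [Fintype n] [DecidableEq n] (W U : Matrix n n ℂ)
    (hW : W * W = 1) (hWh : Wᴴ = W) (hWt : Wᵀ = W)
    (hU : U = ((Real.sqrt 2 : ℝ) : ℂ)⁻¹ • ((1 : Matrix n n ℂ) - Complex.I • W)) :
    Uᴴ * U = 1 ∧ Uᵀ = U ∧ U * W = (-Complex.I) • Uᴴ ∧ W * Uᴴ = Complex.I • U := by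
  have hUh : Uᴴ = ((Real.sqrt 2 : ℝ) : ℂ)⁻¹ • ((1 : Matrix n n ℂ) + Complex.I • W) := by
    rw [hU]; simp [conjTranspose_smul, hWh]
  have h2 : (((Real.sqrt 2 : ℝ) : ℂ)⁻¹) * (((Real.sqrt 2 : ℝ) : ℂ)⁻¹) * 2 = 1 := by
    rw [← mul_inv, ← Complex.ofReal_mul, Real.mul_self_sqrt (by norm_num)]; norm_num
  refine ⟨?_, ?_, ?_, ?_⟩
  · rw [hUh, hU, smul_mul_smul_comm]
    have : ((1 : Matrix n n ℂ) + Complex.I • W) * (1 - Complex.I • W) = (2 : ℂ) • 1 := by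
      simp [mul_sub, add_mul, hW, smul_smul, two_smul]
      abel
    rw [this, smul_smul, h2, one_smul]
  · rw [hU]; simp [hWt]
  · rw [hUh, hU, smul_comm, smul_mul_assoc]
    congr 1
    simp [sub_mul, hW, smul_smul]
    abel
  · rw [hUh, hU, smul_comm, mul_smul_comm]
    congr 1
    simp [mul_add, hW, smul_smul, smul_sub, add_comm]

/-- structural properties of the Bott matrix
`B = U† (Σ_r H_r ⊗ ν_r) U`, with `U = (1/√2)(I - i Z_N ⊗ Z_m)`, built from self-dual
Hermitian matrices `H_r` forming a `δ`-representation of the sphere and unitaries `ν_r`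
satisfying `ν_r† ν_s = -ν_s† ν_r` for `r ≠ s`. -/
theorem bott_matrix_symmetries_selfdual (d N m : ℕ) (hd : 1 ≤ d) (hN : 0 < N) (hm : 0 < m)
    (δ : ℝ) (hδ : 0 < δ)
    (H : Fin (d + 1) → Matrix (Fin N ⊕ Fin N) (Fin N ⊕ Fin N) ℂ)
    (hHherm : ∀ r, (H r)ᴴ = H r)
    (hHdual : ∀ r, dual (H r) = H r)
    (hsq : opNorm (∑ r, H r * H r - 1) ≤ δ)
    (hcomm : ∀ r s, r ≠ s → opNorm (H r * H s - H s * H r) ≤ δ)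
    (ν : Fin (d + 1) → Matrix (Fin m ⊕ Fin m) (Fin m ⊕ Fin m) ℂ)
    (hνunit : ∀ r, (ν r)ᴴ * ν r = 1)
    (hνanti : ∀ r s, r ≠ s → (ν r)ᴴ * ν s = -((ν s)ᴴ * ν r))
    (U B : Matrix ((Fin N ⊕ Fin N) × (Fin m ⊕ Fin m)) ((Fin N ⊕ Fin N) × (Fin m ⊕ Fin m)) ℂ)
    (hUdef : U = ((Real.sqrt 2 : ℝ) : ℂ)⁻¹ •
      ((1 : Matrix ((Fin N ⊕ Fin N) × (Fin m ⊕ Fin m)) ((Fin N ⊕ Fin N) × (Fin m ⊕ Fin m)) ℂ)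
        - Complex.I • (Zmat N ⊗ₖ Zmat m)))
    (hBdef : B = Uᴴ * (∑ r, H r ⊗ₖ ν r) * U) :
    (Uᴴ * U = 1 ∧ opNorm (Bᴴ * B - 1) ≤ (1 + (d * (d + 1) : ℝ) / 2) * δ) ∧
    ((∀ r, (ν r)ᴴ = ν r) → Bᴴ = B) ∧
    ((∀ r, dual (ν r) = ν r) → Bᵀ = B) ∧
    ((∀ r, dual (ν r) = -(ν r)) → Bᵀ = -B) := by
  set S := ∑ r, H r ⊗ₖ ν r with hS
  set W := Zmat N ⊗ₖ Zmat m with hWdef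
  obtain ⟨u1, u2, u3, u4⟩ := U_facts W U
    (by rw [hWdef, ← mul_kronecker_mul, Zmat_sq, Zmat_sq, neg_kron_neg, one_kronecker_one])
    (by rw [hWdef, conjTranspose_kronecker, Zmat_conjTranspose, Zmat_conjTranspose, neg_kron_neg])
    (by rw [hWdef, kron_transpose, Zmat_transpose, Zmat_transpose, neg_kron_neg]) hUdef
  have u5 : U * Uᴴ = 1 := mul_eq_one_comm.mp u1
  have u6 : Uᴴᵀ = Uᴴ := by
    rw [conjTranspose, ← transpose_map, u2, u2]
  have key : U * (W * S * W) * Uᴴ = B := by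
    have : U * (W * S * W) * Uᴴ = (U * W) * S * (W * Uᴴ) := by simp only [mul_assoc]
    rw [this, u3, u4, hBdef]
    simp [smul_smul]
  have hBt : Bᵀ = U * Sᵀ * Uᴴ := by
    rw [hBdef, transpose_mul, transpose_mul, u2, u6, mul_assoc]
  refine ⟨⟨u1, ?_⟩, ?_, ?_, ?_⟩
  · have e : Bᴴ * B - 1 = Uᴴ * (Sᴴ * S - 1) * U := by
      have e1 : Bᴴ * B = Uᴴ * (Sᴴ * ((U * Uᴴ) * S)) * U := by
        rw [hBdef]; simp only [conjTranspose_mul, conjTranspose_conjTranspose, mul_assoc]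
      rw [e1, u5, one_mul, mul_sub, sub_mul, mul_one, u1]
    have hUm := mem_unitary_of_left u1
    have hUm' : Uᴴ ∈ unitary (Matrix _ _ ℂ) := Unitary.star_mem hUm
    open scoped Matrix.Norms.L2Operator in
    rw [opNorm_eq_l2, e, CStarRing.norm_mul_mem_unitary _ hUm, CStarRing.norm_mem_unitary_mul _ hUm']
    exact gram_bound d δ H hHherm hsq hcomm ν hνunit hνanti
  · intro h
    have : Sᴴ = S := by
      rw [hS, conjTranspose_sum]
      exact Finset.sum_congr rfl fun r _ => by rw [conjTranspose_kronecker, hHherm, h]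
    rw [hBdef, conjTranspose_mul, conjTranspose_mul, conjTranspose_conjTranspose, this, mul_assoc]
  · intro h
    have : Sᵀ = W * S * W := by
      rw [hS, transpose_sum, Finset.mul_sum, Finset.sum_mul]
      refine Finset.sum_congr rfl fun r _ => ?_
      rw [kron_transpose, transpose_eq_dual (H r), transpose_eq_dual (ν r), hHdual, h,
        neg_kron_neg, mul_kronecker_mul, mul_kronecker_mul]
    rw [hBt, this, key]
  · intro h
    have : Sᵀ = -(W * S * W) := by
      rw [hS, transpose_sum, Finset.mul_sum, Finset.sum_mul, ← Finset.sum_neg_distrib]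
      refine Finset.sum_congr rfl fun r _ => ?_
      rw [kron_transpose, transpose_eq_dual (H r), transpose_eq_dual (ν r), hHdual, h,
        neg_kron_neg, mul_kronecker_mul, mul_kronecker_mul, kron_neg]
      simp [hWdef]
    rw [hBt, this, ← key]
    simp
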